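/- arXiv:1909.13796 — 2 statements merged into one kernel-verified Lean document; each statement's English description precedes it below -/
import Mathlib

section
/- Let C be a Weyl candidate tensor on Minkowski ℝ⁴ and let T be its Bel–Robinson tensor. Then for every timelike vector u (η(u,u) < 0), the following are equivalent: (i) T(u,u,u,u) = 0; (ii) T = 0 (T(a,b,c,d) = 0 for all a,b,c,d); (iii) C = 0 (C(a,b,c,d) = 0 for all a,b,c,d). [This is the paper's equation (7): the vanishing of the super-energy density W is unambiguous and equivalent to the absence of the Weyl tensor at a point.] -/
open Finset

/-- Components `η^{μν} = diag(−1,1,1,1)` of the (inverse) Minkowski metric. -/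
def ηinv (μ ν : Fin 4) : ℝ := if μ = ν then (if μ = 0 then -1 else 1) else 0

/-- The Minkowski bilinear form on `ℝ⁴`: `η(u,v) = −u₀v₀ + u₁v₁ + u₂v₂ + u₃v₃`. -/
def mink (u v : Fin 4 → ℝ) : ℝ :=
  -(u 0 * v 0) + u 1 * v 1 + u 2 * v 2 + u 3 * v 3

/-- The standard basis `(e_μ)` of `ℝ⁴`. -/
def stdB (μ : Fin 4) : Fin 4 → ℝ := Pi.single μ 1

/-- The alternating symbol on four indices, with `ε₀₁₂₃ = 1`
(Vandermonde product formula). -/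
noncomputable def eps (α β γ δ : Fin 4) : ℝ :=
  (((β : ℕ) - (α : ℕ) : ℝ) * ((γ : ℕ) - (α : ℕ) : ℝ) * ((δ : ℕ) - (α : ℕ) : ℝ) *
   ((γ : ℕ) - (β : ℕ) : ℝ) * ((δ : ℕ) - (β : ℕ) : ℝ) * ((δ : ℕ) - (γ : ℕ) : ℝ)) / 12

/-- A 4-linear form on Minkowski `ℝ⁴`. -/
abbrev FourForm := MultilinearMap ℝ (fun _ : Fin 4 => (Fin 4 → ℝ)) ℝ

/-- Components `C_{αβγδ}` of a 4-linear form in the standard basis. -/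
def comp (C : FourForm) (α β γ δ : Fin 4) : ℝ := C ![stdB α, stdB β, stdB γ, stdB δ]

/-- Components of the left dual `*C`:
`(*C)_{αβγδ} = (1/2) Σ ε_{αβμν} η^{μρ} η^{νσ} C_{ρσγδ}`. -/
noncomputable def dualComp (C : FourForm) (α β γ δ : Fin 4) : ℝ :=
  (1 / 2) * ∑ μ : Fin 4, ∑ ν : Fin 4, ∑ ρ : Fin 4, ∑ σ : Fin 4,
    eps α β μ ν * ηinv μ ρ * ηinv ν σ * comp C ρ σ γ δ

/-- `C` is a Weyl candidate tensor: antisymmetric in the first and last pairs,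
symmetric under interchange of pairs, satisfying the first Bianchi identity,
and traceless. -/
def IsWeylCandidate (C : FourForm) : Prop :=
  (∀ a b c d, C ![a, b, c, d] = -C ![b, a, c, d]) ∧
  (∀ a b c d, C ![a, b, c, d] = -C ![a, b, d, c]) ∧
  (∀ a b c d, C ![a, b, c, d] = C ![c, d, a, b]) ∧
  (∀ a b c d, C ![a, b, c, d] + C ![a, c, d, b] + C ![a, d, b, c] = 0) ∧
  (∀ a b, ∑ μ : Fin 4, ∑ ν : Fin 4, ηinv μ ν * C ![stdB μ, a, stdB ν, b] = 0)

/-- Components of the Bel–Robinson tensor of `C`: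
`T_{αβγδ} = Σ η^{μμ'} η^{νν'} ( C_{αμγν} C_{δν'βμ'} + (*C)_{αμγν} (*C)_{δν'βμ'} )`. -/
noncomputable def belRobinsonComp (C : FourForm) (α β γ δ : Fin 4) : ℝ :=
  ∑ μ : Fin 4, ∑ ν : Fin 4, ∑ μ' : Fin 4, ∑ ν' : Fin 4,
    ηinv μ μ' * ηinv ν ν' *
      (comp C α μ γ ν * comp C δ ν' β μ' + dualComp C α μ γ ν * dualComp C δ ν' β μ')

/-- The Bel–Robinson tensor of `C` as a 4-linear form, evaluated on vectors. -/
noncomputable def belRobinson (C : FourForm) (a b c d : Fin 4 → ℝ) : ℝ :=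
  ∑ α : Fin 4, ∑ β : Fin 4, ∑ γ : Fin 4, ∑ δ : Fin 4,
    a α * b β * c γ * d δ * belRobinsonComp C α β γ δ

/-- The contraction `u^α u^γ f_{αμγν}`. -/
def contractTwice (f : Fin 4 → Fin 4 → Fin 4 → Fin 4 → ℝ) (u : Fin 4 → ℝ) (μ ν : Fin 4) : ℝ :=
  ∑ α, ∑ γ, u α * u γ * f α μ γ ν

/-- The square `η^{μμ'} η^{νν'} M_{μν} M_{ν'μ'}` of a matrix. -/
def minkSq (M : Fin 4 → Fin 4 → ℝ) : ℝ :=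
  ∑ μ, ∑ ν, ηinv μ μ * ηinv ν ν * (M μ ν * M ν μ)

lemma sum_ηinv_mul (μ : Fin 4) (f : Fin 4 → ℝ) :
    ∑ ν, ηinv μ ν * f ν = ηinv μ μ * f μ := by
  rw [Finset.sum_eq_single μ] <;> simp +contextual [ηinv, eq_comm]

lemma contractTwice_mul_contractTwice (f : Fin 4 → Fin 4 → Fin 4 → Fin 4 → ℝ)
    (u : Fin 4 → ℝ) (μ ν : Fin 4) :
    ∑ α, ∑ β, ∑ γ, ∑ δ, u α * u β * u γ * u δ * (f α μ γ ν * f δ ν β μ) =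
      contractTwice f u μ ν * contractTwice f u ν μ := by
  have h : contractTwice f u ν μ = ∑ β, ∑ δ, u δ * u β * f δ ν β μ := Finset.sum_comm
  rw [h, contractTwice, Finset.sum_mul_sum]
  refine Finset.sum_congr rfl fun α _ => Finset.sum_congr rfl fun β _ => ?_
  rw [Finset.sum_mul_sum]
  refine Finset.sum_congr rfl fun γ _ => Finset.sum_congr rfl fun δ _ => ?_
  ring

lemma belRobinsonComp_eq (C : FourForm) (α β γ δ : Fin 4) :
    belRobinsonComp C α β γ δ = ∑ μ, ∑ ν, ηinv μ μ * ηinv ν ν *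
      (comp C α μ γ ν * comp C δ ν β μ + dualComp C α μ γ ν * dualComp C δ ν β μ) := by
  unfold belRobinsonComp
  refine Finset.sum_congr rfl fun μ _ => Finset.sum_congr rfl fun ν _ => ?_
  simp_rw [mul_assoc, ← Finset.mul_sum, sum_ηinv_mul]

lemma sum_comm_four {ι R : Type*} [Fintype ι] [AddCommMonoid R] (f : ι → ι → ι → ι → ι → R) :
    ∑ α, ∑ β, ∑ γ, ∑ δ, ∑ μ, f α β γ δ μ = ∑ μ, ∑ α, ∑ β, ∑ γ, ∑ δ, f α β γ δ μ := by
  refine Eq.trans (Finset.sum_congr rfl fun α _ => ?_) Finset.sum_comm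
  refine Eq.trans (Finset.sum_congr rfl fun β _ => ?_) Finset.sum_comm
  exact Eq.trans (Finset.sum_congr rfl fun γ _ => Finset.sum_comm) Finset.sum_comm

lemma belRobinson_self (C : FourForm) (u : Fin 4 → ℝ) :
    belRobinson C u u u u =
      minkSq (contractTwice (comp C) u) + minkSq (contractTwice (dualComp C) u) := by
  simp_rw [minkSq, ← contractTwice_mul_contractTwice, belRobinson, belRobinsonComp_eq,
    Finset.mul_sum]
  rw [sum_comm_four, ← Finset.sum_add_distrib]
  refine Finset.sum_congr rfl fun μ _ => ?_
  rw [sum_comm_four, ← Finset.sum_add_distrib]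
  refine Finset.sum_congr rfl fun ν _ => ?_
  simp_rw [← Finset.sum_add_distrib]
  refine Finset.sum_congr rfl fun α _ => Finset.sum_congr rfl fun β _ =>
    Finset.sum_congr rfl fun γ _ => Finset.sum_congr rfl fun δ _ => ?_
  ring

lemma time_ne_zero {u : Fin 4 → ℝ} (hu : mink u u < 0) : u 0 ≠ 0 := by
  intro h
  simp only [mink, h] at hu
  nlinarith [sq_nonneg (u 1), sq_nonneg (u 2), sq_nonneg (u 3)]

/-- A symmetric matrix annihilated by a timelike vector has nonnegative square, which
vanishes only for the zero matrix. -/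
lemma minkSq_nonneg_and_eq_zero {M : Fin 4 → Fin 4 → ℝ} (hM : ∀ μ ν, M μ ν = M ν μ)
    {u : Fin 4 → ℝ} (hu : mink u u < 0) (hMu : ∀ μ, ∑ ν, M μ ν * u ν = 0) :
    0 ≤ minkSq M ∧ (minkSq M = 0 → ∀ μ ν, M μ ν = 0) := by
  have h0 := time_ne_zero hu
  obtain ⟨x, hx⟩ : ∃ x, u 1 = x * u 0 := ⟨u 1 / u 0, by field_simp⟩
  obtain ⟨y, hy⟩ : ∃ y, u 2 = y * u 0 := ⟨u 2 / u 0, by field_simp⟩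
  obtain ⟨z, hz⟩ : ∃ z, u 3 = z * u 0 := ⟨u 3 / u 0, by field_simp⟩
  have hs : 0 < 1 - (x ^ 2 + y ^ 2 + z ^ 2) := by
    have : 0 < (u 0) ^ 2 * (1 - (x ^ 2 + y ^ 2 + z ^ 2)) := by
      simp only [mink, hx, hy, hz] at hu; linarith
    exact pos_of_mul_pos_right this (sq_nonneg _)
  set s := 1 - (x ^ 2 + y ^ 2 + z ^ 2) with hsdef
  have hrow : ∀ μ, M μ 0 = -(M μ 1 * x + M μ 2 * y + M μ 3 * z) := by
    intro μ
    have := hMu μ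
    simp only [Fin.sum_univ_four, hx, hy, hz] at this
    apply mul_right_cancel₀ h0
    linarith
  have h00 := hrow 0
  rw [hM 0 1, hM 0 2, hM 0 3, hrow 1, hrow 2, hrow 3, hM 2 1, hM 3 1, hM 3 2] at h00
  have hSq : minkSq M = s ^ 2 * (M 1 1 ^ 2 + M 2 2 ^ 2 + M 3 3 ^ 2
        + 2 * (M 1 2 ^ 2 + M 1 3 ^ 2 + M 2 3 ^ 2))
      + 2 * s * ((M 1 2 * z - M 1 3 * y) ^ 2 + (M 1 3 * x - M 1 1 * z) ^ 2
        + (M 1 1 * y - M 1 2 * x) ^ 2 + (M 2 2 * z - M 2 3 * y) ^ 2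
        + (M 2 3 * x - M 1 2 * z) ^ 2 + (M 1 2 * y - M 2 2 * x) ^ 2
        + (M 2 3 * z - M 3 3 * y) ^ 2 + (M 3 3 * x - M 1 3 * z) ^ 2
        + (M 1 3 * y - M 2 3 * x) ^ 2)
      + ((z * (M 2 2 * z - M 2 3 * y) - y * (M 2 3 * z - M 3 3 * y)) ^ 2
        + (x * (M 3 3 * x - M 1 3 * z) - z * (M 1 3 * x - M 1 1 * z)) ^ 2
        + (y * (M 1 1 * y - M 1 2 * x) - x * (M 1 2 * y - M 2 2 * x)) ^ 2
        + 2 * (z * (M 2 3 * x - M 1 2 * z) - y * (M 3 3 * x - M 1 3 * z)) ^ 2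
        + 2 * (z * (M 1 2 * y - M 2 2 * x) - y * (M 1 3 * y - M 2 3 * x)) ^ 2
        + 2 * (x * (M 1 3 * y - M 2 3 * x) - z * (M 1 1 * y - M 1 2 * x)) ^ 2) := by
    simp only [minkSq, Fin.sum_univ_four, ηinv, hM 0 1, hM 0 2, hM 0 3, hM 2 1, hM 3 1, hM 3 2,
      hrow 1, hrow 2, hrow 3, h00, hsdef]
    norm_num [Fin.ext_iff]
    ring
  have hle : s ^ 2 * (M 1 1 ^ 2 + M 2 2 ^ 2 + M 3 3 ^ 2
        + 2 * (M 1 2 ^ 2 + M 1 3 ^ 2 + M 2 3 ^ 2)) ≤ minkSq M := by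
    rw [hSq]
    refine le_add_of_le_of_nonneg (le_add_of_nonneg_right ?_) ?_ <;> positivity
  refine ⟨le_trans (by positivity) hle, fun h => ?_⟩
  have hsum := le_of_mul_le_mul_left
    (hle.trans_eq (h.trans (mul_zero (s ^ 2)).symm)) (pow_pos hs 2)
  have hz : ∀ t : ℝ, t ^ 2 ≤ 0 → t = 0 := fun t ht => by simpa using le_antisymm ht (sq_nonneg t)
  have q11 := sq_nonneg (M 1 1)
  have q22 := sq_nonneg (M 2 2)
  have q33 := sq_nonneg (M 3 3)
  have q12 := sq_nonneg (M 1 2)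
  have q13 := sq_nonneg (M 1 3)
  have q23 := sq_nonneg (M 2 3)
  have h11 : M 1 1 = 0 := hz _ (by linarith)
  have h22 : M 2 2 = 0 := hz _ (by linarith)
  have h33 : M 3 3 = 0 := hz _ (by linarith)
  have h12 : M 1 2 = 0 := hz _ (by linarith)
  have h13 : M 1 3 = 0 := hz _ (by linarith)
  have h23 : M 2 3 = 0 := hz _ (by linarith)
  intro μ ν
  fin_cases μ <;> fin_cases ν <;>
    simp [hM 0 1, hM 0 2, hM 0 3, hM 2 1, hM 3 1, hM 3 2, hrow 1, hrow 2, hrow 3, h00, h11, h22,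
      h33, h12, h13, h23]

/-- The components of the Hodge dual of a 2-form. -/
noncomputable def hodge (F : Fin 4 → Fin 4 → ℝ) (α β : Fin 4) : ℝ :=
  (1 / 2) * ∑ μ, ∑ ν, eps α β μ ν * (ηinv μ μ * ηinv ν ν * F μ ν)

lemma dualComp_eq (C : FourForm) (α β γ δ : Fin 4) :
    dualComp C α β γ δ = hodge (fun μ ν => comp C μ ν γ δ) α β := by
  unfold dualComp hodge
  congr 1
  refine Finset.sum_congr rfl fun μ _ => Finset.sum_congr rfl fun ν _ => ?_
  simp_rw [mul_assoc, ← Finset.mul_sum, sum_ηinv_mul]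

lemma hodge_apply {F : Fin 4 → Fin 4 → ℝ} (hF : ∀ μ ν, F μ ν = -F ν μ) :
    hodge F 0 1 = F 2 3 ∧ hodge F 0 2 = -F 1 3 ∧ hodge F 0 3 = F 1 2 ∧
    hodge F 1 2 = -F 0 3 ∧ hodge F 1 3 = F 0 2 ∧ hodge F 2 3 = -F 0 1 := by
  simp only [hodge, Fin.sum_univ_four, eps, ηinv]
  norm_num [Fin.ext_iff]
  rw [hF 1 0, hF 2 0, hF 3 0, hF 2 1, hF 3 1, hF 3 2]
  refine ⟨?_, ?_, ?_, ?_, ?_, ?_⟩ <;> ring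

lemma hodge_swap (F : Fin 4 → Fin 4 → ℝ) (α β : Fin 4) : hodge F α β = -hodge F β α := by
  simp only [hodge, ← mul_neg, ← Finset.sum_neg_distrib]
  congr 1
  refine Finset.sum_congr rfl fun μ _ => Finset.sum_congr rfl fun ν _ => ?_
  unfold eps
  ring

/-- A 2-form whose electric and magnetic parts along a timelike vector vanish is zero. -/
lemma eq_zero_of_contract_hodge {F : Fin 4 → Fin 4 → ℝ} (hF : ∀ μ ν, F μ ν = -F ν μ)
    {u : Fin 4 → ℝ} (hu : mink u u < 0) (hE : ∀ ν, ∑ μ, u μ * F μ ν = 0)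
    (hB : ∀ ν, ∑ μ, u μ * hodge F μ ν = 0) (μ ν : Fin 4) : F μ ν = 0 := by
  obtain ⟨d01, d02, d03, d12, d13, d23⟩ := hodge_apply hF
  have hd := hodge_swap F
  have hdiag : ∀ i, F i i = 0 := fun i => by linarith [hF i i]
  have hddiag : ∀ i, hodge F i i = 0 := fun i => by linarith [hd i i]
  have e0 := hE 0
  have e1 := hE 1
  have e2 := hE 2
  have e3 := hE 3
  have b1 := hB 1
  have b2 := hB 2
  have b3 := hB 3
  simp only [Fin.sum_univ_four, hF 1 0, hF 2 0, hF 3 0, hd 2 1, hd 3 1, hd 3 2, hF 2 1, hF 3 1,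
    hF 3 2, hdiag, hddiag, d01, d02, d03, d12, d13, d23] at e0 e1 e2 e3 b1 b2 b3
  have h0 := time_ne_zero hu
  have f01 : F 0 1 = 0 := by
    apply (mul_eq_zero.1 _).resolve_left hu.ne
    rw [mink]
    linear_combination -(u 0 * e1 + u 2 * b3 - u 3 * b2 + u 1 * e0)
  have f02 : F 0 2 = 0 := by
    apply (mul_eq_zero.1 _).resolve_left hu.ne
    rw [mink]
    linear_combination -(u 0 * e2 + u 3 * b1 - u 1 * b3 + u 2 * e0)
  have f03 : F 0 3 = 0 := by
    apply (mul_eq_zero.1 _).resolve_left hu.ne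
    rw [mink]
    linear_combination -(u 0 * e3 + u 1 * b2 - u 2 * b1 + u 3 * e0)
  have f12 : F 1 2 = 0 := by simpa [f01, f02, f03, h0] using b3
  have f13 : F 1 3 = 0 := by simpa [f01, f02, f03, h0] using b2
  have f23 : F 2 3 = 0 := by simpa [f01, f02, f03, h0] using b1
  fin_cases μ <;> fin_cases ν <;>
    simp [hF 1 0, hF 2 0, hF 3 0, hF 2 1, hF 3 1, hF 3 2, hdiag, f01, f02, f03, f12, f13, f23]

lemma comp_swap_left {C : FourForm} (hC : IsWeylCandidate C) (α β γ δ : Fin 4) :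
    comp C α β γ δ = -comp C β α γ δ := hC.1 _ _ _ _

lemma comp_swap_right {C : FourForm} (hC : IsWeylCandidate C) (α β γ δ : Fin 4) :
    comp C α β γ δ = -comp C α β δ γ := hC.2.1 _ _ _ _

lemma comp_swap_pairs {C : FourForm} (hC : IsWeylCandidate C) (α β γ δ : Fin 4) :
    comp C α β γ δ = comp C γ δ α β := hC.2.2.1 _ _ _ _

lemma comp_trace {C : FourForm} (hC : IsWeylCandidate C) (β δ : Fin 4) :
    -comp C 0 β 0 δ + comp C 1 β 1 δ + comp C 2 β 2 δ + comp C 3 β 3 δ = 0 := by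
  have h := hC.2.2.2.2 (stdB β) (stdB δ)
  simp_rw [sum_ηinv_mul, Fin.sum_univ_four] at h
  simpa [ηinv, comp] using h

lemma dualComp_swap_left (C : FourForm) (α β γ δ : Fin 4) :
    dualComp C α β γ δ = -dualComp C β α γ δ := by
  rw [dualComp_eq, dualComp_eq, hodge_swap]

lemma dualComp_swap_right {C : FourForm} (hC : IsWeylCandidate C) (α β γ δ : Fin 4) :
    dualComp C α β γ δ = -dualComp C α β δ γ := by
  rw [dualComp_eq, dualComp_eq, hodge, hodge, ← mul_neg, ← Finset.sum_neg_distrib]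
  simp_rw [← Finset.sum_neg_distrib, comp_swap_right hC _ _ γ δ, mul_neg]

/-- The left dual of a Weyl candidate is symmetric under interchange of pairs. -/
lemma dualComp_swap_pairs {C : FourForm} (hC : IsWeylCandidate C) (α β γ δ : Fin 4) :
    dualComp C α β γ δ = dualComp C γ δ α β := by
  have hl := comp_swap_left hC
  have hr := comp_swap_right hC
  have hp := comp_swap_pairs hC
  have ht := comp_trace hC
  have hdl := dualComp_swap_left C
  have hdr := dualComp_swap_right hC
  have hd : ∀ γ δ, dualComp C 0 1 γ δ = comp C 2 3 γ δ ∧ dualComp C 0 2 γ δ = -comp C 1 3 γ δ ∧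
      dualComp C 0 3 γ δ = comp C 1 2 γ δ ∧ dualComp C 1 2 γ δ = -comp C 0 3 γ δ ∧
      dualComp C 1 3 γ δ = comp C 0 2 γ δ ∧ dualComp C 2 3 γ δ = -comp C 0 1 γ δ := fun γ δ => by
    simp_rw [dualComp_eq]
    exact hodge_apply fun μ ν => hl μ ν γ δ
  have hl0 : ∀ α γ δ, comp C α α γ δ = 0 := fun α γ δ => by linarith [hl α α γ δ]
  have hr0 : ∀ α β γ, comp C α β γ γ = 0 := fun α β γ => by linarith [hr α β γ γ]
  have t00 := ht 0 0
  have t01 := ht 0 1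
  have t02 := ht 0 2
  have t03 := ht 0 3
  have t11 := ht 1 1
  have t12 := ht 1 2
  have t13 := ht 1 3
  have t22 := ht 2 2
  have t23 := ht 2 3
  have t33 := ht 3 3
  simp only [hl0, hr0, hl 1 0, hl 2 0, hl 3 0, hl 2 1, hl 3 1, hl 3 2, hr _ _ 1 0,
    hr _ _ 2 0, hr _ _ 3 0, hr _ _ 2 1, hr _ _ 3 1, hr _ _ 3 2]
    at t00 t01 t02 t03 t11 t12 t13 t22 t23 t33
  have hlt : ∀ α β γ δ : Fin 4, α < β → γ < δ → dualComp C α β γ δ = dualComp C γ δ α β := by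
    intro α β γ δ h1 h2
    fin_cases α <;> fin_cases β <;> first | (exfalso; revert h1; decide) | skip
    all_goals fin_cases γ <;> fin_cases δ <;>
      first | (exfalso; revert h2; decide) | with_reducible rfl | skip
    all_goals
      simp only [Fin.zero_eta, Fin.mk_one, Fin.reduceFinMk, hd,
        hp 0 2 0 1, hp 0 3 0 1, hp 1 2 0 1, hp 1 3 0 1, hp 0 3 0 2, hp 1 2 0 2, hp 2 3 0 2,
        hp 1 3 0 3, hp 2 3 0 3, hp 1 3 1 2, hp 2 3 1 2, hp 2 3 1 3]
      linarith
  have hdl0 : ∀ α γ δ, dualComp C α α γ δ = 0 := fun α γ δ => by linarith [hdl α α γ δ]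
  have hdr0 : ∀ α β γ, dualComp C α β γ γ = 0 := fun α β γ => by linarith [hdr α β γ γ]
  have hlt' : ∀ α β γ δ : Fin 4, α < β → dualComp C α β γ δ = dualComp C γ δ α β := by
    intro α β γ δ h
    rcases lt_trichotomy γ δ with h' | rfl | h'
    · exact hlt _ _ _ _ h h'
    · rw [hdl0, hdr0]
    · rw [hdr, hdl γ, hlt _ _ _ _ h h']
  rcases lt_trichotomy α β with h | rfl | h
  · exact hlt' _ _ _ _ h
  · rw [hdl0, hdr0]
  · rw [hdl, hdr γ, hlt' _ _ _ _ h]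

/-- A 4-linear form is zero when its components are. -/
lemma eq_zero_of_comp {C : FourForm} (h : ∀ α β γ δ, comp C α β γ δ = 0) : C = 0 := by
  refine Module.Basis.ext_multilinear (fun _ => Pi.basisFun ℝ (Fin 4)) fun v => ?_
  have := h (v 0) (v 1) (v 2) (v 3)
  simp only [comp, stdB] at this
  simp only [Pi.basisFun_apply, zero_apply]
  rw [← this]
  congr 1
  funext i
  fin_cases i <;> rfl

lemma contractTwice_symm {f : Fin 4 → Fin 4 → Fin 4 → Fin 4 → ℝ}
    (hf : ∀ α β γ δ, f α β γ δ = f γ δ α β) (u : Fin 4 → ℝ) (μ ν : Fin 4) :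
    contractTwice f u μ ν = contractTwice f u ν μ := by
  unfold contractTwice
  rw [Finset.sum_comm]
  refine Finset.sum_congr rfl fun α _ => Finset.sum_congr rfl fun γ _ => ?_
  rw [hf γ μ α ν, mul_comm (u γ)]

lemma sum_contractTwice_mul {f : Fin 4 → Fin 4 → Fin 4 → Fin 4 → ℝ}
    (hf : ∀ α β γ δ, f α β γ δ = -f α β δ γ) (u : Fin 4 → ℝ) (μ : Fin 4) :
    ∑ ν, contractTwice f u μ ν * u ν = 0 := by
  have h : ∑ ν, contractTwice f u μ ν * u ν =
      ∑ α, ∑ ν, ∑ γ, u α * u γ * f α μ γ ν * u ν := by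
    simp_rw [contractTwice, Finset.sum_mul]
    exact Finset.sum_comm
  rw [h]
  refine Finset.sum_eq_zero fun α _ => ?_
  have h' : ∑ ν, ∑ γ, u α * u γ * f α μ γ ν * u ν =
      -∑ ν, ∑ γ, u α * u γ * f α μ γ ν * u ν := by
    conv_lhs => rw [Finset.sum_comm]
    simp_rw [← Finset.sum_neg_distrib]
    refine Finset.sum_congr rfl fun ν _ => Finset.sum_congr rfl fun γ _ => ?_
    rw [hf α μ ν γ]
    ring
  linarith

lemma hodge_sum (u : Fin 4 → ℝ) (F : Fin 4 → Fin 4 → Fin 4 → ℝ) (α β : Fin 4) :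
    hodge (fun μ ν => ∑ κ, u κ * F κ μ ν) α β = ∑ κ, u κ * hodge (F κ) α β := by
  simp only [hodge, Finset.mul_sum]
  refine Eq.trans (Finset.sum_congr rfl fun μ _ => Finset.sum_comm) (Finset.sum_comm.trans ?_)
  refine Finset.sum_congr rfl fun κ _ => Finset.sum_congr rfl fun μ _ =>
    Finset.sum_congr rfl fun ν _ => ?_
  ring

/-- A Weyl candidate whose electric and magnetic parts along a timelike vector vanish has
vanishing components. -/
lemma comp_eq_zero {C : FourForm} (hC : IsWeylCandidate C) {u : Fin 4 → ℝ} (hu : mink u u < 0)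
    (hE : ∀ μ ν, contractTwice (comp C) u μ ν = 0)
    (hB : ∀ μ ν, contractTwice (dualComp C) u μ ν = 0) (α β γ δ : Fin 4) :
    comp C α β γ δ = 0 := by
  have hFu : ∀ δ α β, ∑ γ, u γ * comp C α β γ δ = 0 := by
    intro δ α β
    refine eq_zero_of_contract_hodge (F := fun α β => ∑ γ, u γ * comp C α β γ δ)
      (fun μ ν => ?_) hu (fun ν => ?_) (fun ν => ?_) α β
    · simp_rw [← Finset.sum_neg_distrib, comp_swap_left hC μ ν, mul_neg]
    · simpa only [contractTwice, Finset.mul_sum, mul_assoc] using hE ν δ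
    · have := hB ν δ
      simp_rw [hodge_sum u (fun γ α β => comp C α β γ δ), ← dualComp_eq]
      simpa only [contractTwice, Finset.mul_sum, mul_assoc] using this
  refine eq_zero_of_contract_hodge (F := fun α β => comp C α β γ δ)
    (fun μ ν => comp_swap_left hC _ _ _ _) hu (fun ν => ?_) (fun ν => ?_) α β
  · simp_rw [comp_swap_pairs hC _ ν γ δ, hFu]
  · simp_rw [← dualComp_eq, dualComp_swap_pairs hC _ ν γ δ, dualComp_eq]
    rw [← hodge_sum u (fun μ α β => comp C α β μ ν)]
    simp [hFu, hodge]

/-- For every timelike vector `u`, the vanishing of the super-energy density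
`T(u,u,u,u)` is equivalent to the vanishing of the whole Bel–Robinson tensor
`T`, and to the vanishing of the Weyl candidate `C` itself. -/
theorem belRobinson_superEnergy_zero_iff
    (C : FourForm) (hC : IsWeylCandidate C)
    (u : Fin 4 → ℝ) (hu : mink u u < 0) :
    (belRobinson C u u u u = 0 ↔ ∀ a b c d : Fin 4 → ℝ, belRobinson C a b c d = 0) ∧
    (belRobinson C u u u u = 0 ↔ ∀ a b c d : Fin 4 → ℝ, C ![a, b, c, d] = 0) := by
  have hE := minkSq_nonneg_and_eq_zero (contractTwice_symm (comp_swap_pairs hC) u) hu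
    (sum_contractTwice_mul (comp_swap_right hC) u)
  have hB := minkSq_nonneg_and_eq_zero (contractTwice_symm (dualComp_swap_pairs hC) u) hu
    (sum_contractTwice_mul (dualComp_swap_right hC) u)
  have hzero : belRobinson C u u u u = 0 → C = 0 := by
    intro h
    rw [belRobinson_self] at h
    exact eq_zero_of_comp <| comp_eq_zero hC hu (hE.2 (by linarith [hE.1, hB.1]))
      (hB.2 (by linarith [hE.1, hB.1]))
  have hT : C = 0 → ∀ a b c d, belRobinson C a b c d = 0 := by
    rintro rfl
    simp [belRobinson, belRobinsonComp, dualComp, comp]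
  refine ⟨⟨fun h => hT (hzero h), fun h => h u u u u⟩, fun h => ?_, fun h => ?_⟩
  · simp [hzero h]
  · exact hT (eq_zero_of_comp fun α β γ δ => h _ _ _ _) u u u u
end

section
/- Let C be a Weyl candidate tensor on Minkowski ℝ⁴, let T be its Bel–Robinson tensor, and let n be a null future-pointing vector (η(n,n) = 0, n₀ > 0). Define the radiant super-momentum Q as the vector with components Q^α = −Σ_{β} η^{αβ} T(e_β, n, n, n). Then Q is null and future-pointing: η(Q,Q) = 0 and Q₀ ≥ 0. [This is Property 1 of the radiant super-momentum 𝒬^α = −n^μ n^ν n^ρ 𝒟^α{}_{μνρ} in the paper: contracting the (rescaled) Bel–Robinson tensor three times with the null normal n of null infinity yields a null, future-pointing vector.] -/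
open Finset

/-- Every null vector with positive time component comes from a spinor `(a, p + iq)`. -/
lemma exists_spinor_of_null {n : Fin 4 → ℝ} (hn : mink n n = 0) (hn0 : n 0 > 0) :
    ∃ a p q : ℝ, n 0 = a ^ 2 + p ^ 2 + q ^ 2 ∧ n 1 = 2 * a * p ∧ n 2 = 2 * a * q ∧
      n 3 = a ^ 2 - p ^ 2 - q ^ 2 := by
  unfold mink at hn
  have hs : 0 ≤ n 0 + n 3 := by nlinarith [sq_nonneg (n 1), sq_nonneg (n 2)]
  rcases hs.eq_or_lt with h | h
  · have h1 : n 1 = 0 := by nlinarith [sq_nonneg (n 1), sq_nonneg (n 2)]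
    have h2 : n 2 = 0 := by nlinarith [sq_nonneg (n 1), sq_nonneg (n 2)]
    have hsq := Real.sq_sqrt hn0.le
    refine ⟨0, √(n 0), 0, ?_, ?_, ?_, ?_⟩ <;> simp only [hsq, h1, h2] <;> linarith
  · have hpos : 0 < (n 0 + n 3) / 2 := by linarith
    obtain ⟨a, ha, hsq⟩ : ∃ a : ℝ, a ≠ 0 ∧ a ^ 2 = (n 0 + n 3) / 2 :=
      ⟨_, (Real.sqrt_pos.2 hpos).ne', Real.sq_sqrt hpos.le⟩
    have key : (n 1 / (2 * a)) ^ 2 + (n 2 / (2 * a)) ^ 2 = (n 0 - n 3) / 2 := by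
      rw [div_pow, div_pow, mul_pow, hsq, ← add_div, div_eq_iff (by positivity)]
      linarith
    refine ⟨a, n 1 / (2 * a), n 2 / (2 * a), by linarith, by field_simp, by field_simp, by linarith⟩

section DualComponents

variable (C : FourForm) (γ δ : Fin 4)

lemma dualComp_self (α : Fin 4) : dualComp C α α γ δ = 0 := by
  simp [dualComp, eps]

lemma dualComp_swap (α β : Fin 4) : dualComp C α β γ δ = -dualComp C β α γ δ := by
  have h : ∀ μ ν, eps α β μ ν = -eps β α μ ν := fun μ ν => by unfold eps; ring
  simp only [dualComp, h, neg_mul, Finset.sum_neg_distrib, mul_neg]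

/-- The left dual as a sum over the six independent bivector planes. -/
lemma dualComp_eq_s9 (hC : IsWeylCandidate C) (α β : Fin 4) :
    dualComp C α β γ δ = eps α β 2 3 * comp C 2 3 γ δ + eps α β 3 1 * comp C 3 1 γ δ
      + eps α β 1 2 * comp C 1 2 γ δ - eps α β 0 1 * comp C 0 1 γ δ
      - eps α β 0 2 * comp C 0 2 γ δ - eps α β 0 3 * comp C 0 3 γ δ := by
  have hc : ∀ i j, comp C i j γ δ = -comp C j i γ δ := fun i j => hC.1 _ _ _ _
  have he : ∀ μ ν, eps α β μ ν = -eps α β ν μ := fun μ ν => by unfold eps; ring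
  have hz : ∀ μ, eps α β μ μ = 0 := fun μ => by unfold eps; ring
  simp only [dualComp, Fin.sum_univ_four, ηinv]
  simp only [hz]
  simp [he 1 0, he 2 0, he 3 0, he 2 1, he 3 2, he 1 3, hc 1 0, hc 2 0, hc 3 0, hc 2 1, hc 3 2,
    hc 1 3]
  ring

end DualComponents

/-- The Bel–Robinson tensor contracted with three copies of `n`, written through the contractions
of `C` and `*C` with one and with two copies of `n`. -/
lemma belRobinson_stdB (C : FourForm) (n : Fin 4 → ℝ) (β : Fin 4) :
    belRobinson C (stdB β) n n n =
      ∑ μ, ∑ ν, ηinv μ μ * ηinv ν ν *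
        ((∑ γ, n γ * comp C β μ γ ν) * (∑ δ, ∑ κ, n δ * n κ * comp C δ ν κ μ) +
         (∑ γ, n γ * dualComp C β μ γ ν) * (∑ δ, ∑ κ, n δ * n κ * dualComp C δ ν κ μ)) := by
  have hB : ∀ κ γ δ, belRobinsonComp C β κ γ δ = ∑ μ, ∑ ν, ηinv μ μ * ηinv ν ν *
      (comp C β μ γ ν * comp C δ ν κ μ + dualComp C β μ γ ν * dualComp C δ ν κ μ) := by
    intro κ γ δ
    unfold belRobinsonComp
    refine Finset.sum_congr rfl fun μ _ => Finset.sum_congr rfl fun ν _ => ?_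
    rw [Finset.sum_eq_single μ, Finset.sum_eq_single ν]
    all_goals simp +contextual [ηinv, eq_comm]
  have hL : belRobinson C (stdB β) n n n =
      ∑ κ, ∑ γ, ∑ δ, n κ * n γ * n δ * belRobinsonComp C β κ γ δ := by
    simp [belRobinson, stdB, Pi.single_apply]
  have hS : ∀ f : Fin 4 → Fin 4 → Fin 4 → Fin 4 → Fin 4 → ℝ,
      ∑ κ, ∑ γ, ∑ δ, ∑ μ, ∑ ν, f κ γ δ μ ν = ∑ μ, ∑ ν, ∑ κ, ∑ γ, ∑ δ, f κ γ δ μ ν := by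
    intro f
    have h2 : ∀ g : Fin 4 → Fin 4 → Fin 4 → ℝ,
        ∑ i, ∑ μ, ∑ ν, g i μ ν = ∑ μ, ∑ ν, ∑ i, g i μ ν := fun g => by
      rw [Finset.sum_comm]
      exact Finset.sum_congr rfl fun μ _ => Finset.sum_comm
    exact (Finset.sum_congr rfl fun κ _ =>
      (Finset.sum_congr rfl fun γ _ => h2 (f κ γ)).trans (h2 _)).trans (h2 _)
  have hE : belRobinson C (stdB β) n n n = ∑ κ, ∑ γ, ∑ δ, ∑ μ, ∑ ν,
      n κ * n γ * n δ * (ηinv μ μ * ηinv ν ν *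
        (comp C β μ γ ν * comp C δ ν κ μ + dualComp C β μ γ ν * dualComp C δ ν κ μ)) := by
    simp only [hL, hB, Finset.mul_sum]
  rw [hE, hS]
  refine Finset.sum_congr rfl fun μ _ => Finset.sum_congr rfl fun ν _ => ?_
  simp only [Fin.sum_univ_four]
  ring

/-- The electric components `E_{ij}` and magnetic components `B_{ij}` determine all components
of a Weyl candidate tensor. -/
lemma weyl_components {C : FourForm} (hC : IsWeylCandidate C) :
    comp C 0 2 0 1 = comp C 0 1 0 2 ∧
    comp C 0 2 2 3 = comp C 0 1 3 1 ∧
    comp C 0 3 0 1 = comp C 0 1 0 3 ∧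
    comp C 0 3 0 2 = comp C 0 2 0 3 ∧
    comp C 0 3 0 3 = -(comp C 0 1 0 1 + comp C 0 2 0 2) ∧
    comp C 0 3 2 3 = comp C 0 1 1 2 ∧
    comp C 0 3 3 1 = comp C 0 2 1 2 ∧
    comp C 0 3 1 2 = -(comp C 0 1 2 3 + comp C 0 2 3 1) ∧
    comp C 2 3 0 1 = comp C 0 1 2 3 ∧
    comp C 2 3 0 2 = comp C 0 1 3 1 ∧
    comp C 2 3 0 3 = comp C 0 1 1 2 ∧
    comp C 2 3 2 3 = -comp C 0 1 0 1 ∧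
    comp C 2 3 3 1 = -comp C 0 1 0 2 ∧
    comp C 2 3 1 2 = -comp C 0 1 0 3 ∧
    comp C 3 1 0 1 = comp C 0 1 3 1 ∧
    comp C 3 1 0 2 = comp C 0 2 3 1 ∧
    comp C 3 1 0 3 = comp C 0 2 1 2 ∧
    comp C 3 1 2 3 = -comp C 0 1 0 2 ∧
    comp C 3 1 3 1 = -comp C 0 2 0 2 ∧
    comp C 3 1 1 2 = -comp C 0 2 0 3 ∧
    comp C 1 2 0 1 = comp C 0 1 1 2 ∧
    comp C 1 2 0 2 = comp C 0 2 1 2 ∧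
    comp C 1 2 0 3 = -(comp C 0 1 2 3 + comp C 0 2 3 1) ∧
    comp C 1 2 2 3 = -comp C 0 1 0 3 ∧
    comp C 1 2 3 1 = -comp C 0 2 0 3 ∧
    comp C 1 2 1 2 = comp C 0 1 0 1 + comp C 0 2 0 2 := by
  obtain ⟨h1, h2, h3, h4, h5⟩ := hC
  have hl : ∀ i j k l, comp C i j k l = -comp C j i k l := fun _ _ _ _ => h1 _ _ _ _
  have hr : ∀ i j k l, comp C i j k l = -comp C i j l k := fun _ _ _ _ => h2 _ _ _ _
  have hs : ∀ i j k l, comp C i j k l = comp C k l i j := fun _ _ _ _ => h3 _ _ _ _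
  have h0 : ∀ i k l, comp C i i k l = 0 := fun i k l => by linarith [hl i i k l]
  have hb : comp C 0 1 2 3 + comp C 0 2 3 1 + comp C 0 3 1 2 = 0 := h4 _ _ _ _
  have ht : ∀ i j, -comp C 0 i 0 j + comp C 1 i 1 j + comp C 2 i 2 j + comp C 3 i 3 j = 0 := by
    intro i j
    have h := h5 (stdB i) (stdB j)
    simpa [Fin.sum_univ_four, ηinv, comp] using h
  have t00 := ht 0 0
  have t01 := ht 0 1
  have t02 := ht 0 2
  have t03 := ht 0 3
  have t11 := ht 1 1
  have t12 := ht 1 2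
  have t13 := ht 1 3
  have t22 := ht 2 2
  have t23 := ht 2 3
  have t33 := ht 3 3
  clear h1 h2 h3 h4 h5 ht
  have hr0 : ∀ i k l, comp C k l i i = 0 := fun i k l => by linarith [hr k l i i]
  simp only [h0, hr0, hl 1 0, hl 2 0, hl 3 0, hl 3 2, hl 1 3, hl 2 1,
    hr _ _ 1 0, hr _ _ 2 0, hr _ _ 3 0, hr _ _ 3 2, hr _ _ 1 3, hr _ _ 2 1]
    at t00 t01 t02 t03 t11 t12 t13 t22 t23 t33 ⊢
  refine ⟨?_, ?_, ?_, ?_, ?_, ?_, ?_, ?_, ?_, ?_, ?_, ?_, ?_, ?_, ?_, ?_, ?_, ?_, ?_, ?_, ?_, ?_,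
    ?_, ?_, ?_, ?_⟩ <;>
    linarith [hs 0 2 0 1, hs 0 3 0 1, hs 0 3 0 2, hs 2 3 0 1, hs 2 3 0 2, hs 2 3 0 3,
      hs 3 1 0 1, hs 3 1 0 2, hs 3 1 0 3, hs 1 2 0 1, hs 1 2 0 2, hs 1 2 0 3,
      hs 3 1 2 3, hs 1 2 2 3, hs 1 2 3 1]

/-- The left dual exchanges the electric planes `0i` with the dual magnetic planes `jk`. -/
lemma dualComp_components {C : FourForm} (hC : IsWeylCandidate C) (γ δ : Fin 4) :
    dualComp C 0 1 γ δ = comp C 2 3 γ δ ∧ dualComp C 0 2 γ δ = comp C 3 1 γ δ ∧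
    dualComp C 0 3 γ δ = comp C 1 2 γ δ ∧ dualComp C 2 3 γ δ = -comp C 0 1 γ δ ∧
    dualComp C 3 1 γ δ = -comp C 0 2 γ δ ∧ dualComp C 1 2 γ δ = -comp C 0 3 γ δ := by
  simp only [dualComp_eq_s9 C _ _ hC]
  refine ⟨?_, ?_, ?_, ?_, ?_, ?_⟩ <;> norm_num [eps]

/-- Real part of the binary cubic `∑ₖ (3 choose k) (r k + i s k) a ^ (3 - k) z ^ k` at a real `a`
and `z = p + iq`. -/
def cubicRe (a p q : ℝ) (r s : Fin 4 → ℝ) : ℝ :=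
  r 0 * a ^ 3 + 3 * a ^ 2 * (r 1 * p - s 1 * q) +
    3 * a * (r 2 * (p ^ 2 - q ^ 2) - s 2 * (2 * p * q)) +
    (r 3 * (p ^ 3 - 3 * p * q ^ 2) - s 3 * (3 * p ^ 2 * q - q ^ 3))

/-- Imaginary part of the binary cubic of `cubicRe`. -/
def cubicIm (a p q : ℝ) (r s : Fin 4 → ℝ) : ℝ :=
  s 0 * a ^ 3 + 3 * a ^ 2 * (r 1 * q + s 1 * p) +
    3 * a * (r 2 * (2 * p * q) + s 2 * (p ^ 2 - q ^ 2)) +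
    (r 3 * (3 * p ^ 2 * q - q ^ 3) + s 3 * (p ^ 3 - 3 * p * q ^ 2))

/-- The Bel–Robinson tensor contracted with three copies of the null vector of the spinor
`o = (a, p + iq)`, in terms of the spinor `Ψ_{ABCD} o^B o^C o^D = (x + iy, u + iv)` built from the
Weyl spinor `Ψ`. -/
lemma belRobinson_eq_spinor {C : FourForm} (hC : IsWeylCandidate C) {n : Fin 4 → ℝ} {a p q : ℝ}
    (h0 : n 0 = a ^ 2 + p ^ 2 + q ^ 2) (h1 : n 1 = 2 * a * p) (h2 : n 2 = 2 * a * q)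
    (h3 : n 3 = a ^ 2 - p ^ 2 - q ^ 2) :
    ∃ x y u v : ℝ,
      belRobinson C (stdB 0) n n n = 2 * (x ^ 2 + y ^ 2 + (u ^ 2 + v ^ 2)) ∧
      belRobinson C (stdB 1) n n n = 4 * (x * u + y * v) ∧
      belRobinson C (stdB 2) n n n = 4 * (y * u - x * v) ∧
      belRobinson C (stdB 3) n n n = 2 * (x ^ 2 + y ^ 2 - (u ^ 2 + v ^ 2)) := by
  have hl : ∀ i j k l, comp C i j k l = -comp C j i k l := fun _ _ _ _ => hC.1 _ _ _ _
  have hr : ∀ i j k l, comp C i j k l = -comp C i j l k := fun _ _ _ _ => hC.2.1 _ _ _ _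
  have hl0 : ∀ i k l, comp C i i k l = 0 := fun i k l => by linarith [hl i i k l]
  have hr0 : ∀ i k l, comp C k l i i = 0 := fun i k l => by linarith [hr k l i i]
  have hds : ∀ i j k l, dualComp C i j k l = -dualComp C j i k l :=
    fun _ _ _ _ => dualComp_swap C _ _ _ _
  have hds0 : ∀ i k l, dualComp C i i k l = 0 := fun _ _ _ => dualComp_self C _ _ _
  simp only [belRobinson_stdB]
  simp only [Fin.sum_univ_four, ηinv, hds0, hl0, hds 1 0, hds 2 0, hds 3 0, hds 3 2, hds 1 3,
    hds 2 1, dualComp_components hC, hl 1 0, hl 2 0, hl 3 0, hl 3 2, hl 1 3, hl 2 1, hr0,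
    hr _ _ 1 0, hr _ _ 2 0, hr _ _ 3 0, hr _ _ 3 2, hr _ _ 1 3, hr _ _ 2 1]
  simp only [weyl_components hC, h0, h1, h2, h3]
  generalize comp C 0 1 0 1 = e11, comp C 0 1 0 2 = e12, comp C 0 1 0 3 = e13,
    comp C 0 2 0 2 = e22, comp C 0 2 0 3 = e23, comp C 0 1 2 3 = b11, comp C 0 1 3 1 = b12,
    comp C 0 1 1 2 = b13, comp C 0 2 3 1 = b22, comp C 0 2 1 2 = b23
  let r : Fin 5 → ℝ := ![e11 - e22 + 2 * b12, -(e13 + b23), -(e11 + e22), e13 - b23,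
    e11 - e22 - 2 * b12]
  let s : Fin 5 → ℝ := ![b22 - b11 + 2 * e12, b13 - e23, b11 + b22, -(b13 + e23),
    b22 - b11 - 2 * e12]
  refine ⟨cubicRe a p q (fun k => r k.castSucc) (fun k => s k.castSucc),
    cubicIm a p q (fun k => r k.castSucc) (fun k => s k.castSucc),
    cubicRe a p q (fun k => r k.succ) (fun k => s k.succ),
    cubicIm a p q (fun k => r k.succ) (fun k => s k.succ), ?_, ?_, ?_, ?_⟩ <;>
  · simp [cubicRe, cubicIm, r, s]
    ring

/-- The radiant super-momentum `Q^α = −Σ_β η^{αβ} T(e_β, n, n, n)`, built by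
contracting the Bel–Robinson tensor of a Weyl candidate three times with a
null future-pointing vector `n`, is null and future-pointing (or zero). -/
theorem radiant_superMomentum_null_future
    (C : FourForm) (hC : IsWeylCandidate C)
    (n : Fin 4 → ℝ) (hn : mink n n = 0) (hn0 : n 0 > 0)
    (Q : Fin 4 → ℝ)
    (hQ : ∀ α, Q α = -∑ β : Fin 4, ηinv α β * belRobinson C (stdB β) n n n) :
    mink Q Q = 0 ∧ Q 0 ≥ 0 := by
  obtain ⟨a, p, q, h0, h1, h2, h3⟩ := exists_spinor_of_null hn hn0
  obtain ⟨x, y, u, v, hT0, hT1, hT2, hT3⟩ := belRobinson_eq_spinor hC h0 h1 h2 h3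
  have hQ0 : Q 0 = 2 * (x ^ 2 + y ^ 2 + (u ^ 2 + v ^ 2)) := by
    simp [hQ, ηinv, hT0]
  have hQ1 : Q 1 = -(4 * (x * u + y * v)) := by simp [hQ, ηinv, hT1]
  have hQ2 : Q 2 = -(4 * (y * u - x * v)) := by simp [hQ, ηinv, hT2]
  have hQ3 : Q 3 = -(2 * (x ^ 2 + y ^ 2 - (u ^ 2 + v ^ 2))) := by simp [hQ, ηinv, hT3]
  refine ⟨?_, ?_⟩
  · simp only [mink, hQ0, hQ1, hQ2, hQ3]
    ring
  · rw [hQ0]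
    positivity
end
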